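/- Fix cog ∈ C with cog > cog*. Let V : ℤ × C → ℝ satisfy the value-bound property with constants t_s, t_max, ρ. Assume E[τ|cog,R] < E[τ|cog,N] < E[τ|cog,H] and that E[τ|cog,N] − E[τ|cog,R] + t_s·γ^{E[τ|cog,H]}/(1 − γ^{t_max}) ≥ (t_max/(1−ρ))·E[γ^τ|cog,R]. Then for each a ∈ {N, H} the map q ↦ Q_V(q,cog,R) − Q_V(q,cog,a) is nondecreasing on ℤ; consequently, if Q_V(q₁,cog,R) > Q_V(q₁,cog,a) for both a ∈ {N,H} at some q₁, then the same strict inequalities hold at every q₂ ≥ q₁, i.e., there is a threshold q₂*(cog) above which action R strictly dominates actions N and H. -/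

import Mathlib

open scoped BigOperators

namespace Fidelity

/-- The actions available to the human operator: skip, rest, normal fidelity, high fidelity. -/
inductive Action : Type
  | S | R | N | H
deriving DecidableEq

/-- Admissible action set: `{S, N, H}` for `cog ≤ cog*` and `{S, R, N, H}` for `cog > cog*`. -/
def Act {C : Type*} [LinearOrder C] (cogStar cog : C) : Finset Action :=
  if cog ≤ cogStar then {Action.S, Action.N, Action.H}
  else {Action.S, Action.R, Action.N, Action.H}

lemma Act_nonempty {C : Type*} [LinearOrder C] (cogStar cog : C) :
    (Act cogStar cog).Nonempty := by
  unfold Act; split <;> exact ⟨Action.S, by simp⟩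

/-- The reward `r(a)`: `r(H) = r_H`, `r(N) = r_N`, `r(S) = r(R) = 0`. -/
noncomputable def rew (rH rN : ℝ) : Action → ℝ
  | Action.H => rH
  | Action.N => rN
  | _ => 0

/-- Expected net immediate reward
`R((q,cog),a) = r(a) − c·E[τ|cog,a]·q − (cλ/2)·E[τ²|cog,a]`. -/
noncomputable def Rimm {C : Type*} (c lam rH rN : ℝ) (Etau Etau2 : C → Action → ℝ)
    (q : ℤ) (cog : C) (a : Action) : ℝ :=
  rew rH rN a - c * Etau cog a * (q : ℝ) - c * lam / 2 * Etau2 cog a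

/-- The Poisson probability of `w` arrivals when the mean number of arrivals is `μ`. -/
noncomputable def poissonPMF (μ : ℝ) (w : ℕ) : ℝ :=
  Real.exp (-μ) * μ ^ w / (w.factorial : ℝ)

/-- The next queue length: `q − 1 + w` under actions `S, N, H` and `q + w` under `R`. -/
def nextQ (a : Action) (q : ℤ) (w : ℕ) : ℤ :=
  if a = Action.R then q + (w : ℤ) else q - 1 + (w : ℤ)

/-- `E[γ^τ | cog, a]`, the expected discount over a sojourn in state `cog` under action `a`. -/
noncomputable def Egamma {C : Type*} [Fintype C] (γ : ℝ) (P : C → Action → ℕ → C → ℝ)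
    (cog : C) (a : Action) : ℝ :=
  ∑' (τ : ℕ), ∑' (cog' : C), γ ^ τ * P cog a τ cog'

/-- The Q-value of action `a` at `(q, cog)` for the continuation value function `V`:
`Q_V(q,cog,a) = R((q,cog),a) + Σ_{τ,cog',w} γ^τ·P(τ,cog'|cog,a)·Poisson(λτ)(w)·V(q',cog')`. -/
noncomputable def Qval {C : Type*} [Fintype C] (c lam rH rN γ : ℝ)
    (Etau Etau2 : C → Action → ℝ) (P : C → Action → ℕ → C → ℝ)
    (V : ℤ → C → ℝ) (q : ℤ) (cog : C) (a : Action) : ℝ :=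
  Rimm c lam rH rN Etau Etau2 q cog a +
    ∑' (τ : ℕ), ∑' (cog' : C), ∑' (w : ℕ),
      γ ^ τ * P cog a τ cog' * poissonPMF (lam * (τ : ℝ)) w * V (nextQ a q w) cog'

/-- `V` satisfies the value-bound property with constants `t_s`, `t_max`, `ρ`:
for all `cog'`, `q` and `Δ ∈ ℕ`,
`c·t_s·Δ/(1 − γ^{t_max}) ≤ V(q,cog') − V(q+Δ,cog') ≤ c·t_max·Δ/(1 − ρ)`. -/
def ValueBound {C : Type*} (c γ ρ : ℝ) (ts tmax : ℕ) (V : ℤ → C → ℝ) : Prop :=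
  ∀ (cog' : C) (q : ℤ) (Δ : ℕ),
    c * (ts : ℝ) * (Δ : ℝ) / (1 - γ ^ tmax) ≤ V q cog' - V (q + (Δ : ℤ)) cog' ∧
    V q cog' - V (q + (Δ : ℤ)) cog' ≤ c * (tmax : ℝ) * (Δ : ℝ) / (1 - ρ)

lemma poissonPMF_nonneg {μ : ℝ} (hμ : 0 ≤ μ) (w : ℕ) : 0 ≤ poissonPMF μ w := by
  unfold poissonPMF; positivity

lemma hasSum_poissonPMF (μ : ℝ) : HasSum (poissonPMF μ) 1 := by
  have h : HasSum (fun w : ℕ => μ ^ w / (w.factorial : ℝ)) (Real.exp μ) := by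
    rw [Real.exp_eq_exp_ℝ]
    exact NormedSpace.expSeries_div_hasSum_exp μ
  have h' := h.mul_left (Real.exp (-μ))
  rw [← Real.exp_add, neg_add_cancel, Real.exp_zero] at h'
  exact h'.congr_fun fun w => by simp only [poissonPMF, mul_div_assoc]

lemma hasSum_poissonPMF_mul_cast (μ : ℝ) :
    HasSum (fun w : ℕ => poissonPMF μ w * (w : ℝ)) μ := by
  rw [← hasSum_nat_add_iff' 1]
  have h := (hasSum_poissonPMF μ).mul_left μ
  simp only [mul_one] at h
  simp only [Finset.sum_range_one, Nat.cast_zero, mul_zero, sub_zero]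
  refine h.congr_fun fun w => ?_
  simp only [poissonPMF, Nat.factorial_succ, Nat.cast_mul, Nat.cast_succ]
  have : (w.factorial : ℝ) ≠ 0 := by positivity
  field_simp
  ring

/-- A function of the integers whose increments along `ℕ` are at most linear is dominated by a
linear function on every half-line. -/
lemma abs_le_of_decrement_bounds {f : ℤ → ℝ} {A B : ℝ} (hA : 0 ≤ A)
    (hf : ∀ (q : ℤ) (n : ℕ), A * n ≤ f q - f (q + n) ∧ f q - f (q + n) ≤ B * n)
    (q : ℤ) (n : ℕ) : |f (q + n)| ≤ |f q| + B * n := by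
  obtain ⟨h₁, h₂⟩ := hf q n
  have h₃ : 0 ≤ A * n := by positivity
  have h₄ : |f (q + n) - f q| ≤ B * n := abs_le.2 ⟨by linarith, by linarith⟩
  have h₅ := abs_sub_abs_le_abs_sub (f (q + n)) (f q)
  linarith

section PoissonMean

variable {f : ℤ → ℝ} {A B μ : ℝ}

lemma hasSum_poissonPMF_mul_affine (μ a b : ℝ) :
    HasSum (fun w : ℕ => poissonPMF μ w * (a + b * w)) (a + b * μ) := by
  have h := ((hasSum_poissonPMF μ).mul_left a).add ((hasSum_poissonPMF_mul_cast μ).mul_left b)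
  rw [mul_one] at h
  exact h.congr_fun fun w => by ring

lemma norm_poissonPMF_mul_le (hμ : 0 ≤ μ) (hA : 0 ≤ A)
    (hf : ∀ (q : ℤ) (n : ℕ), A * n ≤ f q - f (q + n) ∧ f q - f (q + n) ≤ B * n)
    (q : ℤ) (w : ℕ) :
    ‖poissonPMF μ w * f (q + w)‖ ≤ poissonPMF μ w * (|f q| + B * w) := by
  rw [norm_mul, Real.norm_of_nonneg (poissonPMF_nonneg hμ w)]
  exact mul_le_mul_of_nonneg_left (abs_le_of_decrement_bounds hA hf q w) (poissonPMF_nonneg hμ w)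

lemma summable_poissonPMF_mul (hμ : 0 ≤ μ) (hA : 0 ≤ A)
    (hf : ∀ (q : ℤ) (n : ℕ), A * n ≤ f q - f (q + n) ∧ f q - f (q + n) ≤ B * n) (q : ℤ) :
    Summable fun w : ℕ => poissonPMF μ w * f (q + w) :=
  .of_norm_bounded (hasSum_poissonPMF_mul_affine μ _ _).summable
    (norm_poissonPMF_mul_le hμ hA hf q)

lemma abs_tsum_poissonPMF_mul_le (hμ : 0 ≤ μ) (hA : 0 ≤ A)
    (hf : ∀ (q : ℤ) (n : ℕ), A * n ≤ f q - f (q + n) ∧ f q - f (q + n) ≤ B * n) (q : ℤ) :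
    |∑' w : ℕ, poissonPMF μ w * f (q + w)| ≤ |f q| + B * μ :=
  tsum_of_norm_bounded (hasSum_poissonPMF_mul_affine μ _ _) (norm_poissonPMF_mul_le hμ hA hf q)

lemma tsum_poissonPMF_mul_sub_succ_mem_Icc (hμ : 0 ≤ μ) (hA : 0 ≤ A)
    (hf : ∀ (q : ℤ) (n : ℕ), A * n ≤ f q - f (q + n) ∧ f q - f (q + n) ≤ B * n) (q : ℤ) :
    ∑' w : ℕ, poissonPMF μ w * f (q + w) - ∑' w : ℕ, poissonPMF μ w * f (q + 1 + w) ∈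
      Set.Icc A B := by
  have hs := (summable_poissonPMF_mul hμ hA hf q).hasSum.sub
    (summable_poissonPMF_mul hμ hA hf (q + 1)).hasSum
  have hstep (w : ℕ) : A ≤ f (q + w) - f (q + 1 + w) ∧ f (q + w) - f (q + 1 + w) ≤ B := by
    have h := hf (q + w) 1
    rw [add_right_comm q 1]
    simpa using h
  constructor
  · have h := (hasSum_poissonPMF μ).mul_right A
    rw [one_mul] at h
    refine hasSum_le (fun w => ?_) h hs
    rw [← mul_sub]
    exact mul_le_mul_of_nonneg_left (hstep w).1 (poissonPMF_nonneg hμ w)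
  · have h := (hasSum_poissonPMF μ).mul_right B
    rw [one_mul] at h
    refine hasSum_le (fun w => ?_) hs h
    rw [← mul_sub]
    exact mul_le_mul_of_nonneg_left (hstep w).2 (poissonPMF_nonneg hμ w)

end PoissonMean

lemma summable_cast_mul_of_summable_sq_mul {m : ℕ → ℝ} (hm : ∀ τ, 0 ≤ m τ)
    (h2 : Summable fun τ : ℕ => (τ : ℝ) ^ 2 * m τ) : Summable fun τ : ℕ => (τ : ℝ) * m τ := by
  refine .of_nonneg_of_le (fun τ => mul_nonneg τ.cast_nonneg (hm τ)) (fun τ => ?_) h2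
  refine mul_le_mul_of_nonneg_right ?_ (hm τ)
  exact_mod_cast Nat.le_self_pow two_ne_zero τ

lemma summable_pow_mul {m : ℕ → ℝ} {γ : ℝ} (hγ0 : 0 ≤ γ) (hγ1 : γ ≤ 1) (hm : ∀ τ, 0 ≤ m τ)
    (hs : Summable m) : Summable fun τ : ℕ => γ ^ τ * m τ :=
  .of_nonneg_of_le (fun τ => mul_nonneg (pow_nonneg hγ0 τ) (hm τ))
    (fun τ => mul_le_of_le_one_left (hm τ) (pow_le_one₀ hγ0 hγ1)) hs

/-- Jensen's inequality for the convex function `t ↦ γ ^ t` and a distribution on `ℕ`. -/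
lemma rpow_tsum_le_tsum_pow {m : ℕ → ℝ} {γ : ℝ} (hγ0 : 0 < γ) (hγ1 : γ ≤ 1)
    (hm : ∀ τ, 0 ≤ m τ) (hs : HasSum m 1) (h1 : Summable fun τ : ℕ => (τ : ℝ) * m τ) :
    γ ^ (∑' τ : ℕ, (τ : ℝ) * m τ) ≤ ∑' τ : ℕ, γ ^ τ * m τ := by
  set E := ∑' τ : ℕ, (τ : ℝ) * m τ with hE
  have htangent : HasSum (fun τ : ℕ => γ ^ E * (1 + (τ - E) * Real.log γ) * m τ) (γ ^ E) := by
    have h := (hs.mul_left (γ ^ E * (1 - E * Real.log γ))).add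
      (h1.hasSum.mul_left (γ ^ E * Real.log γ))
    rw [← hE, show γ ^ E * (1 - E * Real.log γ) * 1 + γ ^ E * Real.log γ * E = γ ^ E by ring] at h
    exact h.congr_fun fun τ => by ring
  refine hasSum_le (fun τ => mul_le_mul_of_nonneg_right ?_ (hm τ)) htangent
    (summable_pow_mul hγ0.le hγ1 hm hs.summable).hasSum
  have hsplit : γ ^ τ = γ ^ E * Real.exp ((τ - E) * Real.log γ) := by
    rw [← Real.rpow_natCast, mul_comm (_ - E), ← Real.rpow_def_of_pos hγ0, ← Real.rpow_add hγ0]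
    congr 1; ring
  rw [hsplit]
  refine mul_le_mul_of_nonneg_left ?_ (Real.rpow_nonneg hγ0.le _)
  linarith [Real.add_one_le_exp ((τ - E) * Real.log γ)]

/-- Shifting the queue length by one changes the discounted continuation value by the
expected discount times a number between the extreme one-step decrements of `V`. -/
lemma tsum_continuation_sub_succ_mem_Icc {C : Type*} [Fintype C] {p : ℕ → C → ℝ}
    {V : ℤ → C → ℝ} {γ lam A B : ℝ} (hγ0 : 0 ≤ γ) (hγ1 : γ ≤ 1) (hlam : 0 ≤ lam)
    (hA : 0 ≤ A) (hp : ∀ τ x, 0 ≤ p τ x)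
    (h0 : Summable fun τ => ∑ x, p τ x) (h1 : Summable fun τ : ℕ => (τ : ℝ) * ∑ x, p τ x)
    (hV : ∀ (x : C) (q : ℤ) (n : ℕ),
      A * n ≤ V q x - V (q + n) x ∧ V q x - V (q + n) x ≤ B * n) (q : ℤ) :
    (∑' τ : ℕ, ∑ x, ∑' w : ℕ, γ ^ τ * p τ x * poissonPMF (lam * τ) w * V (q + w) x) -
      (∑' τ : ℕ, ∑ x, ∑' w : ℕ, γ ^ τ * p τ x * poissonPMF (lam * τ) w * V (q + 1 + w) x) ∈
      Set.Icc (A * ∑' τ : ℕ, γ ^ τ * ∑ x, p τ x) (B * ∑' τ : ℕ, γ ^ τ * ∑ x, p τ x) := by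
  have hμ (τ : ℕ) : 0 ≤ lam * τ := by positivity
  have hm (τ : ℕ) : 0 ≤ ∑ x, p τ x := Finset.sum_nonneg fun x _ => hp τ x
  have hweight (τ : ℕ) (x : C) : 0 ≤ γ ^ τ * p τ x := mul_nonneg (pow_nonneg hγ0 τ) (hp τ x)
  simp only [mul_assoc (_ * _) (poissonPMF _ _), tsum_mul_left]
  have hsum (s : ℤ) : Summable fun τ : ℕ =>
      ∑ x, γ ^ τ * p τ x * ∑' w : ℕ, poissonPMF (lam * τ) w * V (s + w) x := by
    have hdom : Summable fun τ : ℕ =>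
        (∑ y, |V s y|) * ∑ x, p τ x + |B| * lam * (τ * ∑ x, p τ x) :=
      (h0.mul_left _).add (h1.mul_left _)
    refine .of_norm_bounded hdom fun τ => ?_
    rw [show (∑ y, |V s y|) * ∑ x, p τ x + |B| * lam * (τ * ∑ x, p τ x) =
      ∑ x, p τ x * (∑ y, |V s y| + |B| * (lam * τ)) by rw [← Finset.sum_mul]; ring]
    refine (norm_sum_le _ _).trans (Finset.sum_le_sum fun x _ => ?_)
    rw [norm_mul, Real.norm_of_nonneg (hweight τ x)]
    refine mul_le_mul (mul_le_of_le_one_left (hp τ x) (pow_le_one₀ hγ0 hγ1)) ?_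
      (norm_nonneg _) (hp τ x)
    refine (abs_tsum_poissonPMF_mul_le (f := fun z => V z x) (hμ τ) hA (hV x) s).trans ?_
    exact add_le_add
      (Finset.single_le_sum (f := fun y => |V s y|) (fun y _ => abs_nonneg _) (Finset.mem_univ x))
      (mul_le_mul_of_nonneg_right (le_abs_self B) (hμ τ))
  have hdiff := (hsum q).hasSum.sub (hsum (q + 1)).hasSum
  have hdisc := (summable_pow_mul hγ0 hγ1 hm h0).hasSum
  have hstep (τ : ℕ) (x : C) := tsum_poissonPMF_mul_sub_succ_mem_Icc (f := fun z => V z x)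
    (hμ τ) hA (hV x) q
  constructor
  · refine hasSum_le (fun τ => ?_) (hdisc.mul_left A) hdiff
    rw [← Finset.sum_sub_distrib, Finset.mul_sum, Finset.mul_sum]
    refine Finset.sum_le_sum fun x _ => ?_
    rw [← mul_sub, mul_comm A]
    exact mul_le_mul_of_nonneg_left (hstep τ x).1 (hweight τ x)
  · refine hasSum_le (fun τ => ?_) hdiff (hdisc.mul_left B)
    rw [← Finset.sum_sub_distrib, Finset.mul_sum, Finset.mul_sum]
    refine Finset.sum_le_sum fun x _ => ?_
    rw [← mul_sub, mul_comm B]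
    exact mul_le_mul_of_nonneg_left (hstep τ x).2 (hweight τ x)

/-- for `cog > cog*`, if `V` satisfies the value-bound property,
`E[τ|cog,R] < E[τ|cog,N] < E[τ|cog,H]`, and
`E[τ|cog,N] − E[τ|cog,R] + t_s·γ^{E[τ|cog,H]}/(1−γ^{t_max}) ≥ (t_max/(1−ρ))·E[γ^τ|cog,R]`,
then for each `a ∈ {N,H}` the map `q ↦ Q_V(q,cog,R) − Q_V(q,cog,a)` is nondecreasing;
consequently once `R` strictly dominates both `N` and `H` it does so for all larger
queue lengths. -/
theorem stmt12 {C : Type*} [LinearOrder C] [Fintype C]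
    (cogStar : C) (c lam rH rN γ : ℝ) (ts : ℕ)
    (Etau Etau2 : C → Action → ℝ) (P : C → Action → ℕ → C → ℝ)
    (hc : 0 < c) (hlam : 0 < lam) (hγ : γ ∈ Set.Ioo (0 : ℝ) 1)
    (hrN : 0 ≤ rN) (hrHN : rN < rH) (hts : 1 ≤ ts)
    (hPnn : ∀ cog a τ cog', 0 ≤ P cog a τ cog')
    (hP0 : ∀ cog a cog', P cog a 0 cog' = 0)
    (hPsum : ∀ cog, ∀ a ∈ Act cogStar cog, (∑' (τ : ℕ), ∑' (cog' : C), P cog a τ cog') = 1)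
    (hPS : ∀ cog τ cog', τ ≠ ts → P cog Action.S τ cog' = 0)
    (hEtau : ∀ cog a, Etau cog a = ∑' (τ : ℕ), ∑' (cog' : C), (τ : ℝ) * P cog a τ cog')
    (hEtau2 : ∀ cog a, Etau2 cog a = ∑' (τ : ℕ), ∑' (cog' : C), (τ : ℝ) ^ 2 * P cog a τ cog')
    (hMom2 : ∀ cog a, Summable fun τ : ℕ => (τ : ℝ) ^ 2 * ∑' (cog' : C), P cog a τ cog')
    (tmax : ℕ) (htmax : 1 ≤ tmax) (ρ : ℝ) (hρ : ρ ∈ Set.Ioo (0 : ℝ) 1)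
    (hEle : ∀ cog, ∀ a ∈ Act cogStar cog, Etau cog a ≤ (tmax : ℝ))
    (cog : C) (hcog : cogStar < cog)
    (V : ℤ → C → ℝ) (hV : ValueBound c γ ρ ts tmax V)
    (hord : Etau cog Action.R < Etau cog Action.N ∧ Etau cog Action.N < Etau cog Action.H)
    (hcond : Etau cog Action.N - Etau cog Action.R
          + (ts : ℝ) * γ ^ Etau cog Action.H / (1 - γ ^ tmax)
        ≥ (tmax : ℝ) / (1 - ρ) * Egamma γ P cog Action.R) :
    (∀ a ∈ ({Action.N, Action.H} : Set Action),
      Monotone (fun q : ℤ => Qval c lam rH rN γ Etau Etau2 P V q cog Action.R - Qval c lam rH rN γ Etau Etau2 P V q cog a)) ∧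
    ∀ q₁ q₂ : ℤ, q₁ ≤ q₂ →
      (∀ a ∈ ({Action.N, Action.H} : Set Action),
        Qval c lam rH rN γ Etau Etau2 P V q₁ cog a < Qval c lam rH rN γ Etau Etau2 P V q₁ cog Action.R) →
      (∀ a ∈ ({Action.N, Action.H} : Set Action),
        Qval c lam rH rN γ Etau Etau2 P V q₂ cog a < Qval c lam rH rN γ Etau Etau2 P V q₂ cog Action.R) := by
  obtain ⟨hγ0, hγ1⟩ := hγ
  have hden : 0 < 1 - γ ^ tmax := sub_pos.2 (pow_lt_one₀ hγ0.le hγ1 (by omega))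
  set A := c * (ts : ℝ) / (1 - γ ^ tmax) with hAdef
  set B := c * (tmax : ℝ) / (1 - ρ) with hBdef
  have hA : 0 ≤ A := by positivity
  have hV' (x : C) (q : ℤ) (n : ℕ) :
      A * n ≤ V q x - V (q + n) x ∧ V q x - V (q + n) x ≤ B * n := by
    have h := hV x q n
    rwa [mul_div_right_comm, mul_div_right_comm _ (n : ℝ)] at h
  have hm (a : Action) (τ : ℕ) : 0 ≤ ∑ x, P cog a τ x :=
    Finset.sum_nonneg fun x _ => hPnn cog a τ x
  have hadm (a : Action) : a ∈ Act cogStar cog := by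
    rw [Act, if_neg hcog.not_ge]; cases a <;> simp
  have hsum (a : Action) : HasSum (fun τ => ∑ x, P cog a τ x) 1 := by
    have h := hPsum cog a (hadm a)
    simp only [tsum_fintype] at h
    have hs : Summable fun τ => ∑ x, P cog a τ x := by
      by_contra hns
      rw [tsum_eq_zero_of_not_summable hns] at h
      exact zero_ne_one h
    exact h ▸ hs.hasSum
  have hmom (a : Action) : Summable fun τ : ℕ => (τ : ℝ) * ∑ x, P cog a τ x :=
    summable_cast_mul_of_summable_sq_mul (hm a) (by simpa only [tsum_fintype] using hMom2 cog a)
  have hEgamma (a : Action) : Egamma γ P cog a = ∑' τ : ℕ, γ ^ τ * ∑ x, P cog a τ x := by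
    simp only [Egamma, tsum_fintype, Finset.mul_sum]
  have hJensen (a : Action) : γ ^ Etau cog a ≤ Egamma γ P cog a := by
    rw [hEgamma, hEtau]
    simp only [tsum_fintype, ← Finset.mul_sum]
    exact rpow_tsum_le_tsum_pow hγ0 hγ1.le (hm a) (hsum a) (hmom a)
  have hQ (a : Action) (q : ℤ) :
      Qval c lam rH rN γ Etau Etau2 P V q cog a -
        Qval c lam rH rN γ Etau Etau2 P V (q + 1) cog a - c * Etau cog a ∈
        Set.Icc (A * Egamma γ P cog a) (B * Egamma γ P cog a) := by
    have hcont (s : ℤ) := tsum_continuation_sub_succ_mem_Icc hγ0.le hγ1.le hlam.le hA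
      (hPnn cog a) (hsum a).summable (hmom a) hV' s
    simp only [← hEgamma] at hcont
    simp only [Qval, Rimm, tsum_fintype, nextQ]
    split_ifs
    · convert hcont q using 1
      push_cast; ring
    · convert hcont (q - 1) using 1
      rw [sub_add_cancel, add_sub_cancel_right]
      push_cast; ring
  have hmono : ∀ a ∈ ({Action.N, Action.H} : Set Action),
      Monotone (fun q : ℤ => Qval c lam rH rN γ Etau Etau2 P V q cog Action.R -
        Qval c lam rH rN γ Etau Etau2 P V q cog a) := by
    intro a ha
    have hE : Etau cog Action.N ≤ Etau cog a ∧ Etau cog a ≤ Etau cog Action.H := by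
      rcases ha with rfl | rfl
      · exact ⟨le_rfl, hord.2.le⟩
      · exact ⟨hord.2.le, le_rfl⟩
    have hdisc : γ ^ Etau cog Action.H ≤ Egamma γ P cog a :=
      (Real.rpow_le_rpow_of_exponent_ge hγ0 hγ1.le hE.2).trans (hJensen a)
    refine monotone_int_of_le_succ fun q => ?_
    have h₁ := (hQ Action.R q).2
    have h₂ := (hQ a q).1
    have h₃ := mul_le_mul_of_nonneg_left hdisc hA
    have h₄ : B * Egamma γ P cog Action.R ≤
        c * (Etau cog Action.N - Etau cog Action.R) + A * γ ^ Etau cog Action.H := by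
      calc B * Egamma γ P cog Action.R
          = c * (tmax / (1 - ρ) * Egamma γ P cog Action.R) := by rw [hBdef]; ring
        _ ≤ c * (Etau cog Action.N - Etau cog Action.R
              + ts * γ ^ Etau cog Action.H / (1 - γ ^ tmax)) :=
            mul_le_mul_of_nonneg_left hcond hc.le
        _ = _ := by rw [hAdef]; ring
    have h₅ := mul_le_mul_of_nonneg_left hE.1 hc.le
    linarith
  refine ⟨hmono, fun q₁ q₂ hq h a ha => ?_⟩
  have h₁ := hmono a ha hq
  have h₂ := h a ha
  dsimp only at h₁
  linarith

end Fidelity
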